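/- arXiv:1604.02755 — 2 statements merged into one kernel-verified Lean document; each statement's English description precedes it below -/
import Mathlib

section
/- For every natural number n ≥ 6 there exists an (n,3) circuit code whose length N satisfies 32 · 3^((n−8)/3) ≤ N ≤ (24/22) · 32 · 3^((n−8)/3), where the bounds are real powers and N is compared as a real number. -/
/-- The cyclic distance between two positions on a cycle of length `N`:
the minimum of the two arc lengths. -/
def cycDist {N : ℕ} (i j : ZMod N) : ℕ := min (j - i).val (i - j).val

/-- `C` is an `(n,k)` circuit code of length `N`: a cyclic sequence of `N` distinct
vertices of the hypercube `I(n)` forming an induced cycle such that vertices at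
Hamming distance `< k` are at equal cyclic distance. -/
structure IsCircuitCode (n k N : ℕ) (C : ZMod N → (Fin n → Bool)) : Prop where
  inj : Function.Injective C
  adj : ∀ i : ZMod N, hammingDist (C i) (C (i + 1)) = 1
  induced : ∀ i j : ZMod N, i ≠ j → j ≠ i + 1 → i ≠ j + 1 →
    hammingDist (C i) (C j) ≠ 1
  spread : ∀ i j : ZMod N, hammingDist (C i) (C j) < k →
    cycDist i j = hammingDist (C i) (C j)

/-- There exists an `(n,k)` circuit code of length `N`. -/
def ExistsCircuitCode (n k N : ℕ) : Prop :=
  ∃ C : ZMod N → (Fin n → Bool), IsCircuitCode n k N C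

/-- `K n k` is the maximum length of an `(n,k)` circuit code. -/
noncomputable def K (n k : ℕ) : ℕ := sSup {N | ExistsCircuitCode n k N}

/-- A bi-infinite `N`-periodic walk in `I(n)` in which vertices at Hamming distance `d < 3` are
exactly `d` steps apart modulo `N`. -/
structure IsPeriodicCode (n N : ℕ) (c : ℤ → Fin n → Bool) : Prop where
  periodic : Function.Periodic c N
  adj : ∀ i, hammingDist (c i) (c (i + 1)) = 1
  spread : ∀ i j, hammingDist (c i) (c j) < 3 →
    (N : ℤ) ∣ j - i - hammingDist (c i) (c j) ∨ (N : ℤ) ∣ j - i + hammingDist (c i) (c j)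

def HasPeriodicCode (n N : ℕ) : Prop := ∃ c, IsPeriodicCode n N c

theorem HasPeriodicCode.existsCircuitCode {n N : ℕ} (hN : 6 ≤ N) (h : HasPeriodicCode n N) :
    ExistsCircuitCode n 3 N := by
  obtain ⟨c, hc⟩ := h
  have : NeZero N := ⟨by omega⟩
  have key : ∀ i j : ZMod N, hammingDist (c i.val) (c j.val) < 3 →
      j - i = (hammingDist (c i.val) (c j.val) : ZMod N) ∨
      i - j = (hammingDist (c i.val) (c j.val) : ZMod N) := by
    intro i j hij
    rcases hc.spread _ _ hij with h | h
    · left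
      have := (ZMod.intCast_zmod_eq_zero_iff_dvd _ N).2 h
      push_cast at this
      rw [ZMod.natCast_zmod_val, ZMod.natCast_zmod_val] at this
      linear_combination this
    · right
      have := (ZMod.intCast_zmod_eq_zero_iff_dvd _ N).2 h
      push_cast at this
      rw [ZMod.natCast_zmod_val, ZMod.natCast_zmod_val] at this
      linear_combination -this
  have val_cast : ∀ d < 3, ((d : ℕ) : ZMod N).val = d := fun d hd =>
    ZMod.val_natCast_of_lt (by omega)
  have val_neg_cast : ∀ d < 3, d ≤ (-((d : ℕ) : ZMod N)).val := by
    intro d hd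
    rw [ZMod.neg_val, val_cast d hd]
    split_ifs with h0
    · rw [← val_cast d hd, h0, ZMod.val_zero]
    · omega
  refine ⟨fun i => c i.val, ⟨?_, ?_, ?_, ?_⟩⟩
  · intro i j hij
    have hd : hammingDist (c i.val) (c j.val) = 0 := hammingDist_eq_zero.2 hij
    have := key i j (by omega)
    simp only [hd, Nat.cast_zero, sub_eq_zero] at this
    rcases this with h | h
    · exact h.symm
    · exact h
  · intro i
    have hval : c ((i + 1).val : ℕ) = c ((i.val : ℤ) + 1) := by
      have : (((i + 1).val : ℕ) : ℤ) = ((i.val : ℤ) + 1) % N := by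
        rw [ZMod.val_add, ZMod.val_one'' (by omega)]
        push_cast
        rfl
      rw [this, Int.emod_def, mul_comm]
      exact hc.periodic.sub_int_mul_eq _
    simp only [hval]
    exact hc.adj _
  · intro i j _ h1 h2 hd
    have := key i j (by omega)
    simp only [hd, Nat.cast_one, sub_eq_iff_eq_add, add_comm (1 : ZMod N)] at this
    tauto
  · intro i j hd
    rw [cycDist]
    rcases key i j hd with h | h
    · rw [h, ← neg_sub j i, h, val_cast _ hd, min_eq_left (val_neg_cast _ hd)]
    · rw [h, ← neg_sub i j, h, val_cast _ hd, min_eq_right (val_neg_cast _ hd)]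

/-! ### The product construction -/

theorem hammingDist_fin_append {n m : ℕ} (a a' : Fin n → Bool) (b b' : Fin m → Bool) :
    hammingDist (Fin.append a b) (Fin.append a' b') = hammingDist a a' + hammingDist b b' := by
  simp only [hammingDist, Finset.card_filter, Fin.sum_univ_add, Fin.append_left, Fin.append_right]

theorem staircase_bounds {N T : ℤ} (hT : 0 < T) (hNT : N ≤ T) (hTN : T ≤ 2 * N) {p q : ℤ}
    (hpq : p ≤ q) :
    0 ≤ q * N / T - p * N / T ∧ q * N / T - p * N / T ≤ q - p ∧
      q - p ≤ 2 * (q * N / T - p * N / T) + 1 := by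
  have hp := Int.mul_ediv_add_emod (p * N) T
  have hq := Int.mul_ediv_add_emod (q * N) T
  have hp0 := Int.emod_nonneg (p * N) hT.ne'
  have hq0 := Int.emod_nonneg (q * N) hT.ne'
  have hpT := Int.emod_lt_of_pos (p * N) hT
  have hqT := Int.emod_lt_of_pos (q * N) hT
  set x := p * N / T
  set y := q * N / T
  refine ⟨?_, ?_, ?_⟩
  · by_contra! h
    nlinarith
  · by_contra! h
    nlinarith
  · by_contra! h
    nlinarith

theorem HasPeriodicCode.product {n m N s u : ℕ} (hc : HasPeriodicCode n N)
    (hd : HasPeriodicCode m (4 * s)) (hN : 0 < N) (hu : 4 * u ≤ N) (hus : u.Coprime s) :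
    HasPeriodicCode (n + m) (s * (N + 4 * u)) := by
  obtain ⟨c, hc⟩ := hc
  obtain ⟨d, hd⟩ := hd
  set T : ℤ := N + 4 * u with hT
  have hT0 : 0 < T := by omega
  set X : ℤ → ℤ := fun p => p * N / T with hX
  have bounds : ∀ p q : ℤ, p ≤ q → 0 ≤ X q - X p ∧ X q - X p ≤ q - p ∧
      q - p ≤ 2 * (X q - X p) + 1 := fun p q hpq =>
    staircase_bounds hT0 (by omega) (by omega) hpq
  have shift : ∀ p k : ℤ, X (p + k * T) = X p + k * N := by
    intro p k
    simp only [hX]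
    rw [show (p + k * T) * N = p * N + (k * N) * T by ring, Int.add_mul_ediv_right _ _ hT0.ne']
  have dist : ∀ p q : ℤ, hammingDist (Fin.append (c (X p)) (d (p - X p)))
      (Fin.append (c (X q)) (d (q - X q))) =
      hammingDist (c (X p)) (c (X q)) + hammingDist (d (p - X p)) (d (q - X q)) := fun p q =>
    hammingDist_fin_append _ _ _ _
  refine ⟨fun p => Fin.append (c (X p)) (d (p - X p)), ⟨?_, ?_, ?_⟩⟩
  · intro p
    have h1 : p + ((s * (N + 4 * u) : ℕ) : ℤ) = p + s * T := by push_cast; rw [hT]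
    simp only [h1, shift]
    have h2 : c (X p + s * N) = c (X p) := hc.periodic.int_mul s (X p)
    have h3 : p + s * T - (X p + s * N) = p - X p + u * ((4 * s : ℕ) : ℤ) := by
      push_cast; rw [hT]; ring
    have h4 : d (p - X p + u * ((4 * s : ℕ) : ℤ)) = d (p - X p) := hd.periodic.int_mul u _
    rw [h2, h3, h4]
  · intro p
    rw [dist]
    have h := bounds p (p + 1) (by omega)
    rcases (show X (p + 1) = X p ∨ X (p + 1) = X p + 1 by omega) with h | h
    · rw [h, hammingDist_self, show p + 1 - X p = p - X p + 1 by ring, hd.adj]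
    · rw [h, hc.adj, show p + 1 - (X p + 1) = p - X p by ring, hammingDist_self]
  · intro p q hpq
    simp only [dist] at hpq ⊢
    have hcs := hc.spread (X p) (X q) (by omega)
    have hds := hd.spread (p - X p) (q - X q) (by omega)
    generalize hammingDist (c (X p)) (c (X q)) = a at *
    generalize hammingDist (d (p - X p)) (d (q - X q)) = b at *
    obtain ⟨δ, k, hδ, hk⟩ : ∃ δ k : ℤ, (δ = a ∨ δ = -a) ∧ X q - X p = δ + k * N := by
      rcases hcs with ⟨k, hk⟩ | ⟨k, hk⟩
      · exact ⟨a, k, .inl rfl, by linarith⟩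
      · exact ⟨-a, k, .inr rfl, by linarith⟩
    obtain ⟨ε, l, hε, hl⟩ : ∃ ε l : ℤ, (ε = b ∨ ε = -b) ∧
        q - X q - (p - X p) = ε + l * (4 * s) := by
      rcases hds with ⟨l, hl⟩ | ⟨l, hl⟩
      · exact ⟨b, l, .inl rfl, by push_cast at hl; linarith⟩
      · exact ⟨-b, l, .inr rfl, by push_cast at hl; linarith⟩
    obtain ⟨r, hr⟩ : ∃ r, q = r + k * T := ⟨q - k * T, by ring⟩
    have hXr : X q = X r + k * N := by rw [hr, shift]
    have hXδ : X r - X p = δ := by linarith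
    obtain ⟨z, hz⟩ : ∃ z : ℤ, r - X r - (p - X p) = ε + 4 * z := by
      refine ⟨l * s - k * u, ?_⟩
      rw [hXr, hr, hT] at hl
      linarith
    have hz0 : r - p = δ + ε ∧ (0 ≤ δ ∧ 0 ≤ ε ∨ δ ≤ 0 ∧ ε ≤ 0) := by
      rcases le_total p r with h | h
      · have := bounds p r h
        omega
      · have := bounds r p h
        omega
    have hku : k * u = l * s := by
      rw [hXr, hr, hT] at hl
      linarith [hz0.1]
    obtain ⟨w, hw⟩ : (s : ℤ) ∣ k :=
      (Nat.Coprime.isCoprime hus).symm.dvd_of_dvd_mul_right ⟨l, by rw [hku, mul_comm]⟩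
    have hqp : q - p = δ + ε + ((s * (N + 4 * u) : ℕ) : ℤ) * w := by
      push_cast
      rw [← hT, hr, hw]
      linear_combination hz0.1
    rcases (show δ + ε = ((a + b : ℕ) : ℤ) ∨ δ + ε = -((a + b : ℕ) : ℤ) by omega) with h | h
    · exact .inl ⟨w, by rw [hqp, h]; ring⟩
    · exact .inr ⟨w, by rw [hqp, h]; ring⟩

/-! ### Checking explicit codes -/

/-- The number of ones among the `n` lowest binary digits of `x`. -/
def lowWeight : ℕ → ℕ → ℕ
  | 0, _ => 0
  | n + 1, x => x % 2 + lowWeight n (x / 2)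

def bits (n x : ℕ) : Fin n → Bool := fun i => x.testBit i

theorem hammingDist_bits (n x y : ℕ) :
    hammingDist (bits n x) (bits n y) = lowWeight n (x ^^^ y) := by
  induction n generalizing x y with
  | zero => simp [hammingDist, lowWeight]
  | succ n ih =>
    have h := ih (x / 2) (y / 2)
    simp only [hammingDist, Finset.card_filter] at h ⊢
    simp only [bits] at h
    simp only [bits, Fin.sum_univ_succ, lowWeight, Fin.val_succ, Nat.testBit_succ,
      Nat.xor_div_two, Fin.val_zero, Nat.testBit_zero]
    congr 1
    rw [Nat.xor_mod_two_eq]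
    have := Nat.mod_two_eq_zero_or_one x
    have := Nat.mod_two_eq_zero_or_one y
    split_ifs <;> simp_all <;> omega

/-- The vertices `a` and `b`, located `d` steps apart on a cycle of length `N`, are as far apart
as a code of spread three requires. -/
def checkPair (n N a b d : ℕ) : Bool :=
  Nat.beq (min (lowWeight n (a ^^^ b)) 3) (min (min d (N - d)) 3)

def checkHead (n N a : ℕ) : ℕ → List ℕ → Bool
  | _, [] => true
  | d, b :: l => checkPair n N a b d && checkHead n N a (d + 1) l

def checkPairs (n N : ℕ) : List ℕ → Bool
  | [] => true
  | a :: l => checkHead n N a 1 l && checkPairs n N l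

theorem checkPair_of_checkHead {n N a : ℕ} {l : List ℕ} {d : ℕ} (h : checkHead n N a d l)
    {i : ℕ} (hi : i < l.length) : checkPair n N a (l.getD i 0) (d + i) := by
  induction l generalizing d i with
  | nil => simp at hi
  | cons b l ih =>
    simp only [checkHead, Bool.and_eq_true] at h
    cases i with
    | zero => simpa using h.1
    | succ i =>
      have := ih h.2 (i := i) (by simpa using hi)
      simpa [add_assoc, add_comm 1] using this

theorem checkPair_of_checkPairs {n N : ℕ} {l : List ℕ} (h : checkPairs n N l)
    {i j : ℕ} (hij : i < j) (hj : j < l.length) :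
    checkPair n N (l.getD i 0) (l.getD j 0) (j - i) := by
  induction l generalizing i j with
  | nil => simp at hj
  | cons a l ih =>
    simp only [checkPairs, Bool.and_eq_true] at h
    obtain ⟨j, rfl⟩ : ∃ j', j = j' + 1 := ⟨j - 1, by omega⟩
    cases i with
    | zero =>
      have := checkPair_of_checkHead h.1 (i := j) (by simpa using hj)
      simpa [add_comm 1] using this
    | succ i =>
      have := ih h.2 (i := i) (j := j) (by omega) (by simpa using hj)
      simpa using this

theorem hasPeriodicCode_of_checkPairs {n N : ℕ} (hN : 1 < N) {l : List ℕ} (hl : l.length = N)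
    (h : checkPairs n N l) : HasPeriodicCode n N := by
  have key : ∀ a b : ℕ, a < b → b < N →
      min (hammingDist (bits n (l.getD a 0)) (bits n (l.getD b 0))) 3 =
        min (min (b - a) (N - (b - a))) 3 := by
    intro a b hab hb
    have := checkPair_of_checkPairs h hab (by omega)
    rw [hammingDist_bits]
    exact Nat.eq_of_beq_eq_true this
  have res : ∀ i : ℤ, ∃ a : ℕ, a < N ∧ i % N = a ∧ (N : ℤ) ∣ i - a := by
    intro i
    refine ⟨(i % N).toNat, ?_⟩
    have h0 := Int.emod_nonneg i (b := N) (by omega)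
    have h1 := Int.emod_lt_of_pos i (b := N) (by omega)
    refine ⟨by omega, by omega, ?_⟩
    rw [Int.toNat_of_nonneg h0]
    exact Int.dvd_self_sub_emod
  refine ⟨fun i => bits n (l.getD (i % N).toNat 0), ⟨?_, ?_, ?_⟩⟩
  · intro i
    simp
  · intro i
    obtain ⟨a, ha, hia, -⟩ := res i
    have hia' : (i + 1) % N = ((a + 1 : ℕ) : ℤ) % N := by
      rw [Int.add_emod, hia, Nat.cast_add, Int.add_emod (a : ℤ)]
      simp
    simp only [hia, hia', Int.toNat_natCast]
    rcases (show a + 1 < N ∨ a + 1 = N by omega) with h1 | h1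
    · rw [← Int.natCast_mod, Nat.mod_eq_of_lt h1, Int.toNat_natCast]
      have := key a (a + 1) (by omega) h1
      omega
    · rw [h1, Int.emod_self, Int.toNat_zero, hammingDist_comm]
      have := key 0 a (by omega) ha
      omega
  · intro i j hij
    obtain ⟨a, ha, hia, k, hk⟩ := res i
    obtain ⟨b, hb, hjb, m, hm⟩ := res j
    simp only [hia, hjb, Int.toNat_natCast] at hij ⊢
    rcases lt_trichotomy a b with hab | rfl | hab
    · have := key a b hab hb
      generalize hammingDist (bits n (l.getD a 0)) (bits n (l.getD b 0)) = e at *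
      rcases (show e = b - a ∨ e = N - (b - a) by omega) with h1 | h1
      · exact .inl ⟨m - k, by rw [h1, mul_sub, ← hk, ← hm]; omega⟩
      · exact .inr ⟨m - k + 1, by rw [h1, mul_add, mul_sub, ← hk, ← hm]; omega⟩
    · rw [hammingDist_self]
      exact .inl ⟨m - k, by rw [mul_sub, ← hk, ← hm]; simp⟩
    · have := key b a hab ha
      rw [hammingDist_comm (bits n _)] at this
      generalize hammingDist (bits n (l.getD a 0)) (bits n (l.getD b 0)) = e at *
      rcases (show e = a - b ∨ e = N - (a - b) by omega) with h1 | h1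
      · exact .inr ⟨m - k, by rw [h1, mul_sub, ← hk, ← hm]; omega⟩
      · exact .inl ⟨m - k - 1, by rw [h1, mul_sub, mul_sub, ← hk, ← hm]; omega⟩

theorem hasPeriodicCode_6_16 : HasPeriodicCode 6 16 :=
  hasPeriodicCode_of_checkPairs (by decide) (l :=
    [0, 32, 40, 44, 46, 47, 39, 55, 53, 21, 29, 25, 27, 26, 18, 2])
    rfl (by decide +kernel)

theorem hasPeriodicCode_7_24 : HasPeriodicCode 7 24 :=
  hasPeriodicCode_of_checkPairs (by decide) (l :=
    [0, 16, 24, 88, 92, 93, 85, 69, 71, 7, 15, 14, 46, 62, 54, 118, 114, 115, 123, 107, 105, 41,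
    33, 32])
    rfl (by decide +kernel)

theorem hasPeriodicCode_8_32 : HasPeriodicCode 8 32 :=
  hasPeriodicCode_of_checkPairs (by decide) (l :=
    [0, 128, 160, 176, 177, 179, 51, 35, 43, 41, 105, 104, 120, 88, 90, 91, 95, 127, 255, 239,
    238, 174, 142, 158, 150, 214, 212, 213, 197, 69, 5, 4])
    rfl (by decide +kernel)

theorem hasPeriodicCode_9_48 : HasPeriodicCode 9 48 :=
  hasPeriodicCode_of_checkPairs (by decide) (l :=
    [0, 2, 3, 19, 51, 49, 53, 181, 180, 182, 150, 214, 210, 466, 467, 499, 507, 251, 255, 127,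
    126, 382, 374, 358, 354, 352, 353, 361, 297, 299, 303, 431, 430, 428, 492, 460, 456, 200,
    201, 137, 153, 409, 413, 285, 284, 28, 12, 4])
    rfl (by decide +kernel)

theorem hasPeriodicCode_9_64 : HasPeriodicCode 9 64 :=
  hasPeriodicCode_of_checkPairs (by decide) (l :=
    [0, 256, 288, 289, 291, 295, 263, 279, 277, 405, 437, 436, 438, 446, 414, 398, 396, 460,
    492, 493, 495, 491, 459, 331, 329, 345, 377, 376, 378, 370, 338, 466, 464, 208, 240, 241,
    243, 247, 215, 199, 197, 69, 101, 100, 102, 110, 78, 94, 92, 28, 60, 61, 63, 59, 27, 155,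
    153, 137, 169, 168, 170, 162, 130, 2])
    rfl (by decide +kernel)

theorem hasPeriodicCode_10_68 : HasPeriodicCode 10 68 :=
  hasPeriodicCode_of_checkPairs (by decide) (l :=
    [0, 1, 33, 49, 561, 563, 691, 699, 698, 666, 664, 920, 984, 1016, 888, 880, 368, 336, 337,
    345, 349, 93, 29, 157, 189, 188, 180, 244, 756, 740, 748, 620, 588, 844, 836, 837, 869, 871,
    359, 375, 503, 511, 510, 478, 462, 206, 202, 234, 106, 98, 610, 578, 579, 587, 523, 779,
    783, 911, 943, 942, 934, 930, 418, 416, 424, 296, 264, 8])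
    rfl (by decide +kernel)

theorem hasPeriodicCode_11_96 : HasPeriodicCode 11 96 :=
  hasPeriodicCode_of_checkPairs (by decide) (l :=
    [0, 16, 17, 145, 149, 151, 1175, 1239, 1247, 1243, 1755, 1691, 1689, 1721, 1705, 1193, 1197,
    1196, 1164, 1676, 1668, 1684, 1940, 1972, 948, 950, 438, 310, 278, 342, 350, 94, 90, 122,
    123, 379, 315, 1339, 1337, 1336, 1304, 1816, 792, 793, 797, 799, 783, 1807, 1799, 1863,
    1862, 1990, 966, 710, 706, 722, 754, 1778, 1266, 1250, 1506, 1514, 1450, 1962, 938, 939,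
    931, 419, 387, 451, 449, 457, 461, 205, 717, 589, 581, 597, 629, 631, 1655, 1663, 1662,
    1660, 1644, 1640, 1896, 1897, 1889, 1377, 1381, 1380, 356, 100, 36, 32])
    rfl (by decide +kernel)

theorem hasPeriodicCode_12_140 : HasPeriodicCode 12 140 :=
  hasPeriodicCode_of_checkPairs (by decide) (l :=
    [0, 512, 2560, 2562, 2818, 2946, 898, 1922, 1923, 1667, 1155, 1159, 135, 151, 215, 247,
    2295, 2551, 2535, 3047, 4071, 4007, 3879, 3623, 3621, 3685, 3653, 1605, 1601, 1857, 1889,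
    1905, 2033, 1009, 977, 721, 2769, 2771, 2643, 2899, 2387, 2385, 3409, 3417, 3161, 1113,
    1145, 121, 125, 109, 45, 47, 303, 299, 2347, 3371, 3387, 3899, 3643, 3771, 3755, 3819, 3817,
    3785, 4041, 3977, 3981, 3469, 2445, 2509, 2253, 2255, 2127, 2639, 2895, 847, 975, 1999,
    1998, 1742, 1740, 1676, 652, 684, 680, 696, 568, 824, 792, 794, 1818, 1822, 3870, 3614,
    3102, 3098, 3082, 3210, 3274, 3530, 3546, 3578, 1530, 506, 490, 234, 106, 618, 2666, 2922,
    2920, 2408, 3432, 3424, 3168, 3296, 3312, 2288, 2224, 2192, 2196, 2708, 2964, 3028, 2900,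
    3924, 3956, 3958, 3702, 1654, 1622, 1618, 1106, 1090, 1346, 1350, 1286, 1284, 260, 256])
    rfl (by decide +kernel)

theorem hasPeriodicCode_13_200 : HasPeriodicCode 13 200 :=
  hasPeriodicCode_of_checkPairs (by decide) (l :=
    [0, 4, 2052, 2053, 2069, 2101, 2097, 6193, 4145, 4273, 4337, 4345, 6393, 6395, 6399, 6398,
    7422, 7406, 7404, 7396, 3300, 3301, 3237, 3749, 3621, 7717, 7719, 6695, 6663, 6727, 6855,
    6863, 2767, 2783, 735, 734, 670, 654, 646, 647, 645, 4741, 5765, 5253, 5261, 1165, 1167,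
    1163, 139, 203, 201, 193, 2241, 2240, 2256, 3280, 3288, 3290, 1242, 1498, 1434, 1438, 3486,
    3518, 3510, 3511, 7607, 7591, 7559, 7555, 7553, 7552, 7616, 8128, 7872, 7874, 7906, 3810,
    2786, 2722, 2978, 2982, 2980, 2996, 948, 949, 1013, 997, 993, 992, 960, 962, 5058, 4546,
    4550, 4548, 4580, 4588, 492, 428, 396, 392, 2440, 2441, 2457, 6553, 6557, 6589, 4541, 4413,
    4477, 4469, 6517, 7541, 7537, 7536, 7538, 7522, 6498, 6506, 6474, 6475, 6411, 6923, 7051,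
    7083, 8107, 8105, 4009, 4073, 3945, 3937, 3905, 3921, 1873, 1872, 1808, 1792, 1800, 1801,
    777, 809, 811, 299, 291, 259, 1283, 1287, 1285, 1349, 325, 333, 2381, 2380, 2396, 2398,
    2390, 3414, 1366, 1110, 1046, 1042, 3090, 7186, 7194, 7195, 7227, 7211, 3115, 3119, 2095,
    2094, 2158, 2670, 2926, 3950, 8046, 8014, 8012, 7948, 7692, 7688, 6664, 6680, 4632, 4633,
    4697, 4681, 4685, 4684, 588, 1612, 1644, 1132, 1128, 104, 4200, 4192, 4160, 4096])
    rfl (by decide +kernel)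

set_option maxRecDepth 4000 in
theorem hasPeriodicCode_14_288 : HasPeriodicCode 14 288 :=
  hasPeriodicCode_of_checkPairs (by decide) (l :=
    [0, 1, 2049, 2051, 2563, 6659, 6667, 14859, 14891, 15915, 16171, 7979, 3883, 1835, 1323,
    1067, 5163, 5291, 13483, 13451, 9355, 9419, 1227, 3275, 2251, 2507, 2443, 6539, 14731,
    14723, 15235, 11139, 11137, 9089, 8833, 8841, 649, 2697, 2729, 2217, 3241, 3233, 7329, 7345,
    7409, 7665, 7667, 7539, 15731, 13683, 12659, 13171, 13107, 13235, 14259, 6067, 1971, 1939,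
    1811, 1299, 1303, 1311, 287, 4383, 6431, 14623, 14655, 14651, 10555, 10547, 10291, 10355,
    10867, 10875, 2683, 6779, 6907, 6395, 6399, 4351, 5375, 5343, 5599, 7647, 8159, 16351,
    16223, 15967, 15455, 15453, 13405, 12381, 12893, 12829, 14877, 6685, 6717, 6973, 7037, 6525,
    4477, 4473, 4601, 5113, 1017, 9209, 8953, 8957, 11005, 2813, 3837, 3709, 3677, 3673, 3161,
    3160, 3096, 3352, 7448, 7450, 5402, 13594, 13626, 13754, 13818, 13816, 13784, 15832, 16344,
    15320, 15322, 15194, 15178, 15182, 15214, 14702, 6510, 4462, 5486, 5502, 6014, 6010, 5754,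
    5690, 5818, 5822, 7870, 7358, 7356, 7228, 7212, 15404, 15372, 14348, 14604, 6412, 6540,
    4492, 4494, 4238, 4110, 14, 8206, 8238, 8366, 8430, 238, 2286, 3310, 3566, 3502, 3374,
    11566, 11582, 11580, 11708, 12220, 10172, 9916, 9900, 1708, 3756, 3724, 3726, 2702, 2718,
    2590, 2582, 2646, 2902, 2390, 6486, 14678, 12630, 13654, 13652, 13588, 9492, 8468, 276, 404,
    436, 4532, 4534, 4535, 4519, 5543, 5415, 7463, 15655, 15623, 15622, 15750, 15766, 15510,
    15574, 15572, 15556, 7364, 7236, 3140, 3142, 3143, 1095, 71, 103, 359, 2407, 2405, 10597,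
    14693, 14437, 14439, 14951, 12903, 13927, 13925, 13861, 15909, 7717, 7685, 7941, 8005, 8007,
    5959, 5958, 1862, 1860, 1988, 10180, 9924, 9925, 11973, 3781, 2757, 6853, 6885, 6884, 6886,
    6882, 6818, 7074, 6946, 6434, 4386, 12578, 12546, 8450, 8514, 9026, 9058, 11106, 11104,
    12128, 11616, 15712, 15720, 15721, 15689, 15691, 7499, 5451, 4427, 4419, 4417, 4416, 4160,
    4096])
    rfl (by decide +kernel)

/-! ### Lengths -/

/-- There is a code in `I(n)` whose length is within the required factor of the target. -/
def HasGoodCode (n : ℕ) : Prop :=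
  ∃ N : ℕ, HasPeriodicCode n N ∧ (32 : ℝ) * 3 ^ (((n : ℝ) - 8) / 3) ≤ N ∧
    (N : ℝ) ≤ 24 / 22 * (32 * 3 ^ (((n : ℝ) - 8) / 3))

theorem target_pow_three (n : ℕ) :
    ((32 : ℝ) * 3 ^ (((n : ℝ) - 8) / 3)) ^ 3 = 32 ^ 3 * 3 ^ n / 3 ^ 8 := by
  rw [mul_pow, ← Real.rpow_natCast (_ ^ _) 3, ← Real.rpow_mul (by norm_num)]
  rw [show ((n : ℝ) - 8) / 3 * ((3 : ℕ) : ℝ) = (n : ℝ) - (8 : ℕ) by push_cast; ring,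
    Real.rpow_sub (by norm_num), Real.rpow_natCast, Real.rpow_natCast, mul_div_assoc]

theorem HasPeriodicCode.hasGoodCode {n N : ℕ} (h : HasPeriodicCode n N)
    (h1 : 32 ^ 3 * 3 ^ n ≤ N ^ 3 * 3 ^ 8) (h2 : (11 * N) ^ 3 * 3 ^ 8 ≤ 12 ^ 3 * 32 ^ 3 * 3 ^ n) :
    HasGoodCode n := by
  have ht := target_pow_three n
  have h0 : (0 : ℝ) < 32 * 3 ^ (((n : ℝ) - 8) / 3) := by positivity
  refine ⟨N, h, ?_, ?_⟩
  · refine le_of_pow_le_pow_left₀ (n := 3) (by norm_num) (by positivity) ?_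
    rw [ht, div_le_iff₀ (by positivity)]
    exact_mod_cast h1
  · refine le_of_pow_le_pow_left₀ (n := 3) (by norm_num) (by positivity) ?_
    rw [mul_pow, ht]
    have h2' : ((11 : ℝ) * N) ^ 3 * 3 ^ 8 ≤ 12 ^ 3 * 32 ^ 3 * 3 ^ n := by exact_mod_cast h2
    rw [← mul_div_assoc, le_div_iff₀ (by positivity)]
    linarith

theorem HasGoodCode.add_nine {n : ℕ} (hn : 10 ≤ n) (h : HasGoodCode n) : HasGoodCode (n + 9) := by
  obtain ⟨N, hN, h1, h2⟩ := h
  have hstep : (32 : ℝ) * 3 ^ (((n + 9 : ℕ) - 8 : ℝ) / 3) =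
      27 * (32 * 3 ^ (((n : ℝ) - 8) / 3)) := by
    rw [show (((n + 9 : ℕ) : ℝ) - 8) / 3 = ((n : ℝ) - 8) / 3 + (3 : ℕ) by push_cast; ring,
      Real.rpow_add (by norm_num), Real.rpow_natCast]
    ring
  have hL : (60 : ℝ) ≤ 32 * 3 ^ (((n : ℝ) - 8) / 3) := by
    refine le_of_pow_le_pow_left₀ (n := 3) (by norm_num) (by positivity) ?_
    rw [target_pow_three, le_div_iff₀ (by positivity)]
    have : (3 : ℝ) ^ 10 ≤ 3 ^ n := pow_le_pow_right₀ (by norm_num) hn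
    linarith
  rw [HasGoodCode, hstep]
  generalize (32 : ℝ) * 3 ^ (((n : ℝ) - 8) / 3) = L at *
  have hk0 : 0 ≤ (27 * L / 16 - N - 4) / 8 := by linarith
  have hk := Nat.le_ceil ((27 * L / 16 - N - 4) / 8)
  have hk' := Nat.ceil_lt_add_one hk0
  generalize ⌈(27 * L / 16 - N - 4) / 8⌉₊ = k at *
  have hkN : 4 * (2 * k + 1) ≤ N := by
    have : (4 * (2 * k + 1) : ℝ) ≤ N := by linarith
    exact_mod_cast this
  refine ⟨_, hN.product (s := 16) (u := 2 * k + 1) hasPeriodicCode_9_64 (by omega) hkN ?_, ?_, ?_⟩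
  · exact Nat.Coprime.pow_right 4 (Nat.coprime_two_right.2 ⟨k, rfl⟩)
  · push_cast
    linarith
  · push_cast
    linarith

theorem hasGoodCode {n : ℕ} (hn : 6 ≤ n) : HasGoodCode n := by
  induction n using Nat.strong_induction_on with
  | _ n ih =>
    rcases lt_or_ge n 19 with h | h
    · interval_cases n
      · exact hasPeriodicCode_6_16.hasGoodCode (by norm_num) (by norm_num)
      · exact hasPeriodicCode_7_24.hasGoodCode (by norm_num) (by norm_num)
      · exact hasPeriodicCode_8_32.hasGoodCode (by norm_num) (by norm_num)
      · exact hasPeriodicCode_9_48.hasGoodCode (by norm_num) (by norm_num)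
      · exact hasPeriodicCode_10_68.hasGoodCode (by norm_num) (by norm_num)
      · exact hasPeriodicCode_11_96.hasGoodCode (by norm_num) (by norm_num)
      · exact hasPeriodicCode_12_140.hasGoodCode (by norm_num) (by norm_num)
      · exact hasPeriodicCode_13_200.hasGoodCode (by norm_num) (by norm_num)
      · exact hasPeriodicCode_14_288.hasGoodCode (by norm_num) (by norm_num)
      · exact (hasPeriodicCode_6_16.product (s := 16) (u := 3) hasPeriodicCode_9_64 (by norm_num)
          (by norm_num) (by norm_num)).hasGoodCode (by norm_num) (by norm_num)
      · exact (hasPeriodicCode_9_64.product (s := 6) (u := 11) hasPeriodicCode_7_24 (by norm_num)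
          (by norm_num) (by norm_num)).hasGoodCode (by norm_num) (by norm_num)
      · exact (hasPeriodicCode_9_64.product (s := 8) (u := 13) hasPeriodicCode_8_32 (by norm_num)
          (by norm_num) (by norm_num)).hasGoodCode (by norm_num) (by norm_num)
      · exact (hasPeriodicCode_9_48.product (s := 16) (u := 9) hasPeriodicCode_9_64 (by norm_num)
          (by norm_num) (by norm_num)).hasGoodCode (by norm_num) (by norm_num)
    · obtain ⟨m, rfl⟩ : ∃ m, n = m + 9 := ⟨n - 9, by omega⟩
      exact (ih m (by omega) (by omega)).add_nine (by omega)

theorem stmt_5 (n : ℕ) (hn : 6 ≤ n) :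
    ∃ N : ℕ, ExistsCircuitCode n 3 N ∧
      (32 : ℝ) * 3 ^ (((n : ℝ) - 8) / 3) ≤ (N : ℝ) ∧
      (N : ℝ) ≤ 24 / 22 * (32 * 3 ^ (((n : ℝ) - 8) / 3)) := by
  obtain ⟨N, hN, h1, h2⟩ := hasGoodCode hn
  refine ⟨N, hN.existsCircuitCode ?_, h1, h2⟩
  have hL : (6 : ℝ) ≤ 32 * 3 ^ (((n : ℝ) - 8) / 3) := by
    refine le_of_pow_le_pow_left₀ (n := 3) (by norm_num) (by positivity) ?_
    rw [target_pow_three, le_div_iff₀ (by positivity)]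
    have : (3 : ℝ) ^ 6 ≤ 3 ^ n := pow_le_pow_right₀ (by norm_num) hn
    linarith
  exact_mod_cast hL.trans h1
end

section
/- (Singleton) If there exists an (n,k) circuit code of length N with k ≥ 3 and k odd, then there exists an (n + (k+1)/2, k) circuit code of length N + (k+1)⌊N/(k+1)⌋. -/
theorem cycDist_comm {N : ℕ} (i j : ZMod N) : cycDist i j = cycDist j i :=
  min_comm _ _

theorem cycDist_natCast {N : ℕ} {p q : ℕ} (hpq : p ≤ q) (hqp : q ≤ p + N) :
    cycDist (p : ZMod N) (q : ZMod N) = min (q - p) (N - (q - p)) := by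
  have h₁ : (q : ZMod N) - p = ((q - p : ℕ) : ZMod N) := (Nat.cast_sub hpq).symm
  have h₂ : (p : ZMod N) - q = ((N - (q - p) : ℕ) : ZMod N) := by
    rw [Nat.cast_sub (by omega), Nat.cast_sub hpq, ZMod.natCast_self]
    ring
  unfold cycDist
  rw [h₁, h₂, ZMod.val_natCast, ZMod.val_natCast]
  rcases Nat.eq_zero_or_pos (q - p) with h | h
  · simp [h]
  · rcases Nat.lt_or_ge (q - p) N with h' | h'
    · rw [Nat.mod_eq_of_lt h', Nat.mod_eq_of_lt (by omega)]
    · have : q - p = N := by omega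
      simp [this]

theorem cycDist_eq_zero {N : ℕ} {i j : ZMod N} (h : cycDist i j = 0) : i = j := by
  unfold cycDist at h
  rcases min_choice (j - i).val (i - j).val with h' | h' <;> rw [h', ZMod.val_eq_zero] at h
  · exact (sub_eq_zero.mp h).symm
  · exact sub_eq_zero.mp h

theorem eq_add_one_of_cycDist_eq_one {N : ℕ} [NeZero N] {i j : ZMod N} (h : cycDist i j = 1) :
    j = i + 1 ∨ i = j + 1 := by
  have key : ∀ a b : ZMod N, (a - b).val = 1 → a = b + 1 := by
    intro a b hab
    have : a - b = 1 := by
      rw [← ZMod.natCast_zmod_val (a - b), hab, Nat.cast_one]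
    rw [← this]
    ring
  unfold cycDist at h
  rcases min_choice (j - i).val (i - j).val with h' | h' <;> rw [h'] at h
  · exact Or.inl (key _ _ h)
  · exact Or.inr (key _ _ h)

/-- For `k ≥ 2`, the adjacency and spread conditions imply the other two. -/
theorem isCircuitCode_of_adj_of_spread {n k N : ℕ} [NeZero N] (hk : 2 ≤ k)
    {C : ZMod N → (Fin n → Bool)}
    (adj : ∀ i : ZMod N, hammingDist (C i) (C (i + 1)) = 1)
    (spread : ∀ i j : ZMod N, hammingDist (C i) (C j) < k →
      cycDist i j = hammingDist (C i) (C j)) :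
    IsCircuitCode n k N C where
  inj i j hij := by
    have h0 : hammingDist (C i) (C j) = 0 := hammingDist_eq_zero.mpr hij
    exact cycDist_eq_zero ((spread i j (by omega)).trans h0)
  adj := adj
  induced i j _ hji hij h1 := by
    rcases eq_add_one_of_cycDist_eq_one ((spread i j (by omega)).trans h1) with h | h
    · exact hji h
    · exact hij h
  spread := spread

theorem hammingDist_append {m n : ℕ} (x x' : Fin m → Bool) (y y' : Fin n → Bool) :
    hammingDist (Fin.append x y) (Fin.append x' y') = hammingDist x x' + hammingDist y y' := by
  simp only [hammingDist, Finset.card_filter, Fin.sum_univ_add, Fin.append_left, Fin.append_right]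

/-- The cycle of length `2 * r` in the `r`-dimensional cube that flips the coordinates
cyclically, one after the other. -/
def antipodalCycle (r v : ℕ) : Fin r → Bool := fun j => decide (Odd ((v + j) / r))

theorem antipodalCycle_add_mul {r : ℕ} (hr : 0 < r) (v m : ℕ) :
    antipodalCycle r (v + 2 * r * m) = antipodalCycle r v := by
  funext j
  have : (v + 2 * r * m + j) / r = (v + j) / r + 2 * m := by
    rw [show v + 2 * r * m + j = v + j + r * (2 * m) by ring, Nat.add_mul_div_left _ _ hr]
  simp only [antipodalCycle, this, decide_eq_decide, Nat.odd_iff]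
  omega

theorem hammingDist_antipodalCycle_antipode {r : ℕ} (hr : 0 < r) (v : ℕ) :
    hammingDist (antipodalCycle r v) (antipodalCycle r (v + r)) = r := by
  have h : ∀ j : Fin r, antipodalCycle r v j ≠ antipodalCycle r (v + r) j := by
    intro j
    have : (v + r + j) / r = (v + j) / r + 1 := by
      rw [show v + r + j = v + j + r by ring, Nat.add_div_right _ hr]
    simp only [antipodalCycle, this, ne_eq, decide_eq_decide, Nat.odd_iff]
    omega
  simp [hammingDist, h]

theorem hammingDist_antipodalCycle_succ_le {r : ℕ} (v : ℕ) :
    hammingDist (antipodalCycle r v) (antipodalCycle r (v + 1)) ≤ 1 := by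
  have h : ∀ j : Fin r, antipodalCycle r v j ≠ antipodalCycle r (v + 1) j → r ∣ v + j + 1 := by
    intro j hj
    by_contra hd
    apply hj
    simp only [antipodalCycle]
    rw [show v + 1 + (j : ℕ) = v + j + 1 by ring, Nat.succ_div, if_neg hd, add_zero]
  unfold hammingDist
  rw [Finset.card_le_one]
  intro a ha b hb
  have ha' := h a (Finset.mem_filter.mp ha).2
  have hb' := h b (Finset.mem_filter.mp hb).2
  have hmod : (v + 1) + (a : ℕ) ≡ (v + 1) + b [MOD r] := by
    have := ((Nat.modEq_zero_iff_dvd.mpr ha').trans (Nat.modEq_zero_iff_dvd.mpr hb').symm)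
    convert this using 1 <;> ring
  exact Fin.ext ((Nat.ModEq.add_left_cancel' _ hmod).eq_of_lt_of_lt a.2 b.2)

theorem hammingDist_antipodalCycle_add_le {r : ℕ} (v b : ℕ) :
    hammingDist (antipodalCycle r v) (antipodalCycle r (v + b)) ≤ b := by
  induction b with
  | zero => simp
  | succ b ih =>
    have h₁ := hammingDist_triangle (antipodalCycle r v) (antipodalCycle r (v + b))
      (antipodalCycle r (v + (b + 1)))
    have h₂ := hammingDist_antipodalCycle_succ_le (r := r) (v + b)
    rw [add_assoc] at h₂
    omega

theorem hammingDist_antipodalCycle_add {r : ℕ} (hr : 0 < r) (v : ℕ) {b : ℕ} (hb : b ≤ r) :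
    hammingDist (antipodalCycle r v) (antipodalCycle r (v + b)) = b := by
  apply le_antisymm (hammingDist_antipodalCycle_add_le v b)
  have h₁ := hammingDist_triangle (antipodalCycle r v) (antipodalCycle r (v + b))
    (antipodalCycle r (v + r))
  have h₂ := hammingDist_antipodalCycle_add_le (r := r) (v + b) (r - b)
  rw [show v + b + (r - b) = v + r by omega] at h₂
  rw [hammingDist_antipodalCycle_antipode hr] at h₁
  omega

theorem le_hammingDist_antipodalCycle_add {r : ℕ} (hr : 0 < r) (v : ℕ) {b : ℕ} (hb : r ≤ b) :
    2 * r ≤ hammingDist (antipodalCycle r v) (antipodalCycle r (v + b)) + b := by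
  have h₁ := hammingDist_triangle (antipodalCycle r v) (antipodalCycle r (v + b))
    (antipodalCycle r (v + r))
  have h₂ := hammingDist_antipodalCycle_add_le (r := r) (v + r) (b - r)
  rw [show v + r + (b - r) = v + b by omega] at h₂
  rw [hammingDist_antipodalCycle_antipode hr, hammingDist_comm (antipodalCycle r (v + b))] at h₁
  omega

/-- On an arc with `b` steps in the antipodal cycle and at least `b - 1` other steps, a small
distance forces `b ≤ r`, so that the antipodal cycle contributes exactly `b`. -/
theorem hammingDist_antipodalCycle_of_short {r : ℕ} (hr : 0 < r) {a b v : ℕ} (hba : b ≤ a + 1)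
    (h : a + hammingDist (antipodalCycle r v) (antipodalCycle r (v + b)) < 2 * r - 1) :
    b ≤ r ∧ hammingDist (antipodalCycle r v) (antipodalCycle r (v + b)) = b := by
  rcases le_total b r with hb | hb
  · exact ⟨hb, hammingDist_antipodalCycle_add hr v hb⟩
  · have := le_hammingDist_antipodalCycle_add hr v hb
    omega

/-- The closed walk that alternates between steps of `C` and steps of the antipodal cycle until
the latter has made `L` steps, and then follows `C` only. -/
def interleave {n N : ℕ} (C : ZMod N → (Fin n → Bool)) (r L t : ℕ) : Fin (n + r) → Bool :=
  Fin.append (C ((t - min (t / 2) L : ℕ) : ZMod N)) (antipodalCycle r (min (t / 2) L))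

theorem hammingDist_interleave_succ {n k N r : ℕ} (hr : 0 < r) {C : ZMod N → (Fin n → Bool)}
    (hC : IsCircuitCode n k N C) (L t : ℕ) :
    hammingDist (interleave C r L t) (interleave C r L (t + 1)) = 1 := by
  simp only [interleave, hammingDist_append]
  have hcases : (min ((t + 1) / 2) L = min (t / 2) L ∧
        t + 1 - min (t / 2) L = t - min (t / 2) L + 1) ∨
      (min ((t + 1) / 2) L = min (t / 2) L + 1 ∧
        t + 1 - (min (t / 2) L + 1) = t - min (t / 2) L) := by omega
  rcases hcases with ⟨h₁, h₂⟩ | ⟨h₁, h₂⟩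
  · rw [h₁, h₂, Nat.cast_add, Nat.cast_one, hC.adj, hammingDist_self]
  · rw [h₁, h₂, hammingDist_self, hammingDist_antipodalCycle_add hr _ hr]

theorem interleave_period {n N r m : ℕ} (hr : 0 < r) (C : ZMod N → (Fin n → Bool))
    (hm : 2 * r * m ≤ N) :
    interleave C r (2 * r * m) (N + 2 * r * m) = interleave C r (2 * r * m) 0 := by
  have h : min ((N + 2 * r * m) / 2) (2 * r * m) = 2 * r * m := by omega
  have h' := antipodalCycle_add_mul hr 0 m
  rw [zero_add] at h'
  simp [interleave, h, h']

theorem interleave_spread {n k N r m : ℕ} (hr : 0 < r) (hk : k = 2 * r - 1)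
    {C : ZMod N → (Fin n → Bool)} (hC : IsCircuitCode n k N C) (hm : 2 * r * m ≤ N) {s t : ℕ}
    (hst : s ≤ t) (ht : t < N + 2 * r * m)
    (h : hammingDist (interleave C r (2 * r * m) s) (interleave C r (2 * r * m) t) < k) :
    cycDist (s : ZMod (N + 2 * r * m)) (t : ZMod (N + 2 * r * m)) =
      hammingDist (interleave C r (2 * r * m) s) (interleave C r (2 * r * m) t) := by
  rw [cycDist_natCast hst (by omega)]
  simp only [interleave, hammingDist_append] at h ⊢
  have hL : 2 * r * m = 0 ∨ 2 * r ≤ 2 * r * m := by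
    rcases Nat.eq_zero_or_pos m with h0 | h0
    · exact Or.inl (by simp [h0])
    · exact Or.inr (Nat.le_mul_of_pos_right _ h0)
  have hper := antipodalCycle_add_mul hr (min (s / 2) (2 * r * m)) m
  have hold := hC.spread _ _ (lt_of_le_of_lt (Nat.le_add_right _ _) h)
  rw [cycDist_natCast (by omega) (by omega)] at hold
  rw [← hold] at h ⊢
  generalize 2 * r * m = L at *
  obtain ⟨v, hv⟩ : ∃ v, v = min (s / 2) L := ⟨_, rfl⟩
  obtain ⟨w, hw⟩ : ∃ w, w = min (t / 2) L := ⟨_, rfl⟩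
  rw [← hv, ← hw] at h ⊢
  rw [← hv] at hper
  rcases le_total (t - w - (s - v)) (N - (t - w - (s - v))) with hd | hd
  · rw [min_eq_left hd] at h ⊢
    have := hammingDist_antipodalCycle_of_short (r := r) hr (v := v) (b := w - v)
      (a := t - w - (s - v)) (by omega)
    rw [show v + (w - v) = w by omega, ← hk] at this
    obtain ⟨hb, he⟩ := this h
    rw [he]
    omega
  · rw [min_eq_right hd] at h ⊢
    have := hammingDist_antipodalCycle_of_short (r := r) hr (v := w) (b := v + L - w)
      (a := N - (t - w - (s - v))) (by omega)
    rw [show w + (v + L - w) = v + L by omega, hper, hammingDist_comm, ← hk] at this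
    obtain ⟨hb, he⟩ := this h
    rw [he]
    omega

theorem existsCircuitCode_interleave {n r N m : ℕ} (hr : 2 ≤ r) (hm : 2 * r * m ≤ N)
    (h : ExistsCircuitCode n (2 * r - 1) N) :
    ExistsCircuitCode (n + r) (2 * r - 1) (N + 2 * r * m) := by
  obtain ⟨C, hC⟩ := h
  have hN : 0 < N := by
    rcases Nat.eq_zero_or_pos N with rfl | hN
    · exact absurd hC.inj (not_injective_infinite_finite (α := ℤ) C)
    · exact hN
  have : NeZero (N + 2 * r * m) := ⟨by omega⟩
  have hr₀ : 0 < r := by omega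
  refine ⟨fun i => interleave C r (2 * r * m) i.val,
    isCircuitCode_of_adj_of_spread (by omega) ?_ ?_⟩
  · intro i
    have hi := ZMod.val_lt i
    have hsucc : interleave C r (2 * r * m) (i + 1).val =
        interleave C r (2 * r * m) (i.val + 1) := by
      have hval : (i + 1).val = (i.val + 1) % (N + 2 * r * m) := by
        rw [← ZMod.val_natCast, Nat.cast_add, ZMod.natCast_zmod_val, Nat.cast_one]
      rcases Nat.lt_or_ge (i.val + 1) (N + 2 * r * m) with hlt | hge
      · rw [hval, Nat.mod_eq_of_lt hlt]
      · have heq : i.val + 1 = N + 2 * r * m := by omega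
        rw [hval, heq, Nat.mod_self, interleave_period hr₀ C hm]
    simp only [hsucc]
    exact hammingDist_interleave_succ hr₀ hC _ _
  · intro i j hij
    rcases le_total i.val j.val with hle | hle
    · have := interleave_spread hr₀ rfl hC hm hle (ZMod.val_lt j) hij
      rwa [ZMod.natCast_zmod_val, ZMod.natCast_zmod_val] at this
    · rw [hammingDist_comm] at hij
      have := interleave_spread hr₀ rfl hC hm hle (ZMod.val_lt i) hij
      rw [ZMod.natCast_zmod_val, ZMod.natCast_zmod_val] at this
      rw [cycDist_comm, this, hammingDist_comm]

theorem stmt_8 (n k N : ℕ) (hk : 3 ≤ k) (hodd : Odd k) (h : ExistsCircuitCode n k N) :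
    ExistsCircuitCode (n + (k + 1) / 2) k (N + (k + 1) * (N / (k + 1))) := by
  obtain ⟨r, rfl⟩ : ∃ r, k = 2 * r - 1 := by
    obtain ⟨q, rfl⟩ := hodd
    exact ⟨q + 1, by omega⟩
  have hr : 2 * r - 1 + 1 = 2 * r := by omega
  rw [hr, Nat.mul_div_cancel_left r two_pos]
  exact existsCircuitCode_interleave (by omega) (Nat.mul_div_le N (2 * r)) h
end
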